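/- arXiv:1907.01168 — 3 statements merged into one kernel-verified Lean document; each statement's English description precedes it below -/
import Mathlib

section
/- A language L over a distributed alphabet (Σ₁,…,Σ_k) is accepted by some product system with globals having subset-acceptance if and only if L can be expressed as a finite union of languages, each accepted by a product system with globals having product-acceptance. -/
set_option linter.unusedVariables false

open scoped Classical

/-- A distribution of an alphabet `Sig` over `k` locations: a tuple of nonempty
sets of letters covering the whole alphabet. -/
structure DistAlphabet (Sig : Type) (k : ℕ) where
  comp : Fin k → Set Sig
  nonempty : ∀ i, (comp i).Nonempty
  covers : ∀ a, ∃ i, a ∈ comp i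

namespace DistAlphabet

/-- The set of locations of a letter. -/
def loc {Sig : Type} {k : ℕ} (D : DistAlphabet Sig k) (a : Sig) : Set (Fin k) :=
  {i | a ∈ D.comp i}

end DistAlphabet
/-- A product system with globals (PS-globals) over a distribution:
a tuple of (finite-state) sequential systems together with, for each letter,
a set of global moves, and a set of final product states. -/
structure PSG {Sig : Type} {k : ℕ} (D : DistAlphabet Sig k) where
  P : Fin k → Type
  finite : ∀ i, Finite (P i)
  init : ∀ i, P i
  finalLocal : ∀ i, Set (P i)
  trans : ∀ i, Set (P i × Sig × P i)
  trans_mem : ∀ i m, m ∈ trans i → m.2.1 ∈ D.comp i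
  globals : ∀ a : Sig, Set (∀ i : D.loc a, P i.1 × P i.1)
  globals_trans : ∀ a g, g ∈ globals a → ∀ i : D.loc a, ((g i).1, a, (g i).2) ∈ trans i.1
  final : Set (∀ i, P i)

namespace PSG

variable {Sig : Type} {k : ℕ} {D : DistAlphabet Sig k}

/-- One step of a product system with globals: applying a global `a`-move,
the components in `loc a` move according to it, the other components stay put. -/
def step (A : PSG D) (R : ∀ i, A.P i) (a : Sig) (Q : ∀ i, A.P i) : Prop :=
  ∃ g ∈ A.globals a,
    (∀ i : D.loc a, R i.1 = (g i).1 ∧ Q i.1 = (g i).2) ∧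
    ∀ i, i ∉ D.loc a → Q i = R i

/-- Runs of a product system with globals, starting at a given product state. -/
inductive RunFrom (A : PSG D) (R0 : ∀ i, A.P i) : List Sig → (∀ i, A.P i) → Prop
  | nil : RunFrom A R0 [] R0
  | snoc : ∀ {w : List Sig} {R : ∀ i, A.P i} {a : Sig} {Q : ∀ i, A.P i},
      RunFrom A R0 w R → A.step R a Q → RunFrom A R0 (w ++ [a]) Q

/-- The language of a product system with globals. -/
def Lang (A : PSG D) : Set (List Sig) :=
  {w | ∃ R ∈ A.final, A.RunFrom A.init w R}

/-- Product-acceptance: the final product states are exactly the product of the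
component final states. -/
def productAcc (A : PSG D) : Prop :=
  A.final = {R | ∀ i, R i ∈ A.finalLocal i}

/-- Subset-acceptance: the final product states form a subset of the product of the
component final states. -/
def subsetAcc (A : PSG D) : Prop :=
  A.final ⊆ {R | ∀ i, R i ∈ A.finalLocal i}

/-- The set of pre-states of a global move (as pairs of a location and a local state). -/
def preSet (A : PSG D) (a : Sig) (g : ∀ i : D.loc a, A.P i.1 × A.P i.1) :
    Set (Σ i : Fin k, A.P i) :=
  {x | ∃ h : x.1 ∈ D.loc a, (g ⟨x.1, h⟩).1 = x.2}

/-- Same source property: any two global moves whose sets of pre-states intersect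
have equal sets of pre-states. -/
def sameSource (A : PSG D) : Prop :=
  ∀ (a b : Sig) (ga : ∀ i : D.loc a, A.P i.1 × A.P i.1) (gb : ∀ i : D.loc b, A.P i.1 × A.P i.1),
    ga ∈ A.globals a → gb ∈ A.globals b →
    (A.preSet a ga ∩ A.preSet b gb).Nonempty → A.preSet a ga = A.preSet b gb

/-- Product moves property: within a same-source compartment of global `a`-moves,
every componentwise combination of post-states of moves of the compartment is the
post-state tuple of a single global move of the compartment. -/
def productMoves (A : PSG D) : Prop :=
  ∀ (a : Sig) (g0 : ∀ i : D.loc a, A.P i.1 × A.P i.1), g0 ∈ A.globals a →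
    ∀ F : (D.loc a) → ∀ j : D.loc a, A.P j.1 × A.P j.1,
      (∀ i, F i ∈ A.globals a ∧ A.preSet a (F i) = A.preSet a g0) →
      ∃ g ∈ A.globals a, A.preSet a g = A.preSet a g0 ∧ ∀ i : D.loc a, (g i).2 = (F i i).2

/-- A global move is enabled at a product state if the state agrees with its pre-states. -/
def enabled (A : PSG D) (a : Sig) (g : ∀ i : D.loc a, A.P i.1 × A.P i.1)
    (R : ∀ i, A.P i) : Prop :=
  ∀ i : D.loc a, R i.1 = (g i).1

/-- Liveness: from every reachable product state, every global move can eventually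
become enabled. -/
def live (A : PSG D) : Prop :=
  ∀ a g, g ∈ A.globals a → ∀ w R, A.RunFrom A.init w R →
    ∃ v Q, A.RunFrom R v Q ∧ A.enabled a g Q

end PSG

namespace PSG

variable {Sig : Type} {k : ℕ} {D : DistAlphabet Sig k}

/-- The product system `A` with `R` as its only final product state. -/
def withFinal (A : PSG D) (R : ∀ i, A.P i) : PSG D :=
  { A with
    finalLocal := fun i => {R i}
    final := {R} }

theorem withFinal_productAcc (A : PSG D) (R : ∀ i, A.P i) : (A.withFinal R).productAcc :=
  Set.ext fun _ => funext_iff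

theorem runFrom_of_runFrom_withFinal (A : PSG D) (R : ∀ i, A.P i) {R₀ : ∀ i, A.P i} {w : List Sig}
    {Q : ∀ i, (A.withFinal R).P i} (h : (A.withFinal R).RunFrom R₀ w Q) :
    A.RunFrom R₀ w Q := by
  induction h with
  | nil => exact RunFrom.nil (A := A)
  | snoc _ hs ih => exact RunFrom.snoc (A := A) ih hs

theorem runFrom_withFinal (A : PSG D) (R : ∀ i, A.P i) {R₀ : ∀ i, A.P i} {w : List Sig}
    {Q : ∀ i, A.P i} (h : A.RunFrom R₀ w Q) : (A.withFinal R).RunFrom R₀ w Q := by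
  induction h with
  | nil => exact RunFrom.nil (A := A.withFinal R)
  | snoc _ hs ih => exact RunFrom.snoc (A := A.withFinal R) ih hs

theorem mem_lang_withFinal (A : PSG D) (R : ∀ i, A.P i) (w : List Sig) :
    w ∈ (A.withFinal R).Lang ↔ A.RunFrom A.init w R := by
  constructor
  · rintro ⟨Q, hQR, hQ⟩
    have hrun : A.RunFrom A.init w Q := A.runFrom_of_runFrom_withFinal R hQ
    exact (show Q = R from hQR) ▸ hrun
  · exact fun h => ⟨R, rfl, A.runFrom_withFinal R h⟩

/-- The parallel simulation of finitely many product systems: on every letter each simulated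
system either performs one of its global moves or is abandoned (recorded by `none`) at all
participating locations. A product state is final if some system that was never abandoned is in
a final product state. -/
def union {n : ℕ} (As : Fin n → PSG D) : PSG D where
  P i := ∀ j, Option ((As j).P i)
  finite i := by
    have := fun j => (As j).finite i
    infer_instance
  init i j := some ((As j).init i)
  finalLocal _ := Set.univ
  trans i := {m | m.2.1 ∈ D.comp i}
  trans_mem _ _ h := h
  globals a := {g | ∀ j,
    (∃ f ∈ (As j).globals a, ∀ i, (g i).1 j = some (f i).1 ∧ (g i).2 j = some (f i).2) ∨
      ∀ i, (g i).2 j = none}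
  globals_trans _ _ _ i := i.2
  final := {R | ∃ j, ∃ F ∈ (As j).final, ∀ i, R i j = some (F i)}

theorem union_subsetAcc {n : ℕ} (As : Fin n → PSG D) : (union As).subsetAcc :=
  fun _ _ _ => Set.mem_univ _

theorem exists_runFrom_union {n : ℕ} (As : Fin n → PSG D) (j : Fin n) {w : List Sig}
    {F : ∀ i, (As j).P i} (h : (As j).RunFrom (As j).init w F) :
    ∃ R, (union As).RunFrom (union As).init w R ∧ ∀ i, R i j = some (F i) := by
  induction h with
  | nil => exact ⟨_, .nil, fun _ => rfl⟩
  | @snoc w F a F' _ hs ih =>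
    obtain ⟨R, hR, hRF⟩ := ih
    obtain ⟨f, hf, hfl, hfn⟩ := hs
    let S : ∀ i, (union As).P i := fun i j' =>
      if hj : j' = j then some (hj ▸ F' i) else none
    have hS : ∀ i, S i j = some (F' i) := fun i => by simp [S]
    let Q : ∀ i, (union As).P i := fun i => if i ∈ D.loc a then S i else R i
    have hQ : ∀ i : D.loc a, Q i = S i := fun i => if_pos i.2
    have hQ' : ∀ i, i ∉ D.loc a → Q i = R i := fun i hi => if_neg hi
    refine ⟨Q, .snoc hR ⟨fun i => (R i, Q i), ?_, fun _ => ⟨rfl, rfl⟩, hQ'⟩, ?_⟩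
    · intro j'
      by_cases hj : j' = j
      · subst hj
        refine .inl ⟨f, hf, fun i => ⟨?_, ?_⟩⟩
        · exact (hRF i).trans (congrArg some (hfl i).1)
        · exact (congrFun (hQ i) _).trans ((hS i).trans (congrArg some (hfl i).2))
      · exact .inr fun i => (congrFun (hQ i) _).trans (dif_neg hj)
    · intro i
      by_cases hi : i ∈ D.loc a
      · exact (congrFun (hQ ⟨i, hi⟩) _).trans (hS i)
      · rw [hQ' i hi, hRF, hfn i hi]

theorem runFrom_of_runFrom_union {n : ℕ} (As : Fin n → PSG D) (j : Fin n) {w : List Sig}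
    {R : ∀ i, (union As).P i} (h : (union As).RunFrom (union As).init w R)
    (F : ∀ i, (As j).P i) (hF : ∀ i, R i j = some (F i)) :
    (As j).RunFrom (As j).init w F := by
  induction h generalizing F with
  | nil =>
    obtain rfl : (As j).init = F := funext fun i => Option.some.inj (hF i)
    exact .nil
  | @snoc w R a Q _ hs ih =>
    obtain ⟨g, hg, hgl, hgn⟩ := hs
    rcases hg j with ⟨f, hf, hgf⟩ | hnone
    · let E : ∀ i, (As j).P i := fun i => if hi : i ∈ D.loc a then (f ⟨i, hi⟩).1 else F i
      have hE : ∀ i : D.loc a, E i = (f i).1 := fun i => dif_pos i.2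
      have hE' : ∀ i, i ∉ D.loc a → E i = F i := fun i hi => dif_neg hi
      refine .snoc (ih E fun i => ?_)
        ⟨f, hf, fun i => ⟨hE i, Option.some.inj ?_⟩, fun i hi => (hE' i hi).symm⟩
      · by_cases hi : i ∈ D.loc a
        · rw [(hgl ⟨i, hi⟩).1, (hgf ⟨i, hi⟩).1, hE ⟨i, hi⟩]
        · rw [← hgn i hi, hF, hE' i hi]
      · rw [← hF, (hgl i).2, (hgf i).2]
    · obtain ⟨i, hi⟩ := D.covers a
      have h := hF i
      rw [(hgl ⟨i, hi⟩).2, hnone ⟨i, hi⟩] at h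
      cases h

theorem lang_union {n : ℕ} (As : Fin n → PSG D) : (union As).Lang = ⋃ j, (As j).Lang := by
  ext w
  rw [Set.mem_iUnion]
  constructor
  · rintro ⟨R, ⟨j, F, hF, hRF⟩, hR⟩
    exact ⟨j, F, hF, runFrom_of_runFrom_union As j hR F hRF⟩
  · rintro ⟨j, F, hF, h⟩
    obtain ⟨R, hR, hRF⟩ := exists_runFrom_union As j h
    exact ⟨R, ⟨j, F, hF, hRF⟩, hR⟩

end PSG

/-- A language over a distributed alphabet is accepted by some
product system with globals having subset-acceptance iff it is a finite union of
languages accepted by product systems with globals having product-acceptance. -/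
theorem psglobals_subsetAcc_iff_finite_union_productAcc
    {Sig : Type} {k : ℕ} (D : DistAlphabet Sig k) (L : Set (List Sig)) :
    (∃ A : PSG D, A.subsetAcc ∧ A.Lang = L) ↔
    (∃ (n : ℕ) (As : Fin n → PSG D), (∀ j, (As j).productAcc) ∧ L = ⋃ j, (As j).Lang) := by
  constructor
  · rintro ⟨A, -, rfl⟩
    have := A.finite
    obtain ⟨n, ⟨e⟩⟩ := Finite.exists_equiv_fin A.final
    refine ⟨n, fun j => A.withFinal (e.symm j), fun j => A.withFinal_productAcc _, ?_⟩
    ext w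
    simp only [Set.mem_iUnion, PSG.mem_lang_withFinal]
    constructor
    · rintro ⟨R, hR, h⟩
      exact ⟨e ⟨R, hR⟩, by simpa using h⟩
    · rintro ⟨j, h⟩
      exact ⟨_, (e.symm j).2, h⟩
  · rintro ⟨n, As, -, rfl⟩
    exact ⟨PSG.union As, PSG.union_subsetAcc As, PSG.lang_union As⟩
end

section
/- Let (N, M₀, 𝒢) be the net system constructed from a product system with globals A (places = union of local state sets, transitions = global moves with their labels, flow given by the pre- and post-states of component local moves, initial marking = initial product state, final markings = final product states). If A has the same source property then N is a free choice net; if in addition A has the product moves property then N has the distributed choice property. -/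
set_option linter.unusedVariables false

open scoped Classical

/-- The indicator of a proposition, as a natural number. -/
noncomputable def ind (P : Prop) : ℕ := if P then 1 else 0

/-- A labelled net system: a finite labelled net (every transition having nonempty
pre-set and post-set), together with an initial marking and a finite set of final
markings. `pre t p` means `(p,t) ∈ F` and `post t p` means `(t,p) ∈ F`. -/
structure NetSys (Sig : Type) where
  Place : Type
  Trans : Type
  finiteP : Finite Place
  finiteT : Finite Trans
  pre : Trans → Place → Prop
  post : Trans → Place → Prop
  preNonempty : ∀ t, ∃ p, pre t p
  postNonempty : ∀ t, ∃ p, post t p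
  label : Trans → Sig
  initM : Place → ℕ
  finals : Set (Place → ℕ)
  finalsFin : finals.Finite

namespace NetSys

variable {Sig : Type}

/-- The token-game firing rule: `t` is enabled at `M` (all pre-places marked) and
firing it produces `M'`. -/
def fires (N : NetSys Sig) (M : N.Place → ℕ) (t : N.Trans) (M' : N.Place → ℕ) : Prop :=
  (∀ p, N.pre t p → 1 ≤ M p) ∧
  ∀ p, M' p + ind (N.pre t p) = M p + ind (N.post t p)

/-- Firing sequences from a marking. -/
inductive FireSeq (N : NetSys Sig) (M0 : N.Place → ℕ) : List N.Trans → (N.Place → ℕ) → Prop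
  | nil : FireSeq N M0 [] M0
  | snoc : ∀ {σ : List N.Trans} {M : N.Place → ℕ} {t : N.Trans} {M' : N.Place → ℕ},
      FireSeq N M0 σ M → N.fires M t M' → FireSeq N M0 (σ ++ [t]) M'

/-- The (L-type) language of a labelled net system. -/
def Lang (N : NetSys Sig) : Set (List Sig) :=
  {w | ∃ σ M, N.FireSeq N.initM σ M ∧ M ∈ N.finals ∧ w = σ.map N.label}

/-- 1-boundedness: every reachable marking puts at most one token on each place. -/
def OneBounded (N : NetSys Sig) : Prop :=
  ∀ σ M, N.FireSeq N.initM σ M → ∀ p, M p ≤ 1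

/-- The (directed) edges of the subnet generated by places `S` and transitions `T`. -/
inductive SubnetEdge (N : NetSys Sig) (S : Set N.Place) (T : Set N.Trans) :
    (N.Place ⊕ N.Trans) → (N.Place ⊕ N.Trans) → Prop
  | pt : ∀ {p t}, p ∈ S → t ∈ T → N.pre t p → SubnetEdge N S T (Sum.inl p) (Sum.inr t)
  | tp : ∀ {t p}, p ∈ S → t ∈ T → N.post t p → SubnetEdge N S T (Sum.inr t) (Sum.inl p)

/-- Membership of a node in the subnet generated by `S` and `T`. -/
def nodeIn (N : NetSys Sig) (S : Set N.Place) (T : Set N.Trans) :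
    (N.Place ⊕ N.Trans) → Prop
  | Sum.inl p => p ∈ S
  | Sum.inr t => t ∈ T

/-- The subnet generated by `S` and `T` is a component: it is closed under pre- and
post-sets of its places, it is an S-net (every transition has exactly one pre-place
and one post-place in it), and it is connected. -/
def IsComponent (N : NetSys Sig) (S : Set N.Place) (T : Set N.Trans) : Prop :=
  (∀ p ∈ S, ∀ t, (N.pre t p ∨ N.post t p) → t ∈ T) ∧
  (∀ t ∈ T, (∃! p, p ∈ S ∧ N.pre t p) ∧ (∃! p, p ∈ S ∧ N.post t p)) ∧
  (∀ x y, N.nodeIn S T x → N.nodeIn S T y →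
    Relation.ReflTransGen (N.SubnetEdge S T) x y ∨ Relation.ReflTransGen (N.SubnetEdge S T) y x)

/-- The cluster of a node `x`: the least set of nodes containing `x`, closed under
post-sets of its places and pre-sets of its transitions. -/
inductive InCluster (N : NetSys Sig) (x : N.Place ⊕ N.Trans) : (N.Place ⊕ N.Trans) → Prop
  | base : InCluster N x x
  | placePost : ∀ {p t}, InCluster N x (Sum.inl p) → N.pre t p → InCluster N x (Sum.inr t)
  | transPre : ∀ {t p}, InCluster N x (Sum.inr t) → N.pre t p → InCluster N x (Sum.inl p)

/-- Free choice: all transitions of each cluster have the same pre-set. -/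
def FreeChoice (N : NetSys Sig) : Prop :=
  ∀ x t t', N.InCluster x (Sum.inr t) → N.InCluster x (Sum.inr t') →
    ∀ p, N.pre t p ↔ N.pre t' p

/-- Distributed choice property, with respect to an S-cover `S` indexed by the
locations of the distribution `D`: for every cluster and every letter `a`, every
componentwise combination of post-places (one per location of `a`) of the
`a`-labelled transitions of the cluster is the tuple of post-places of a single
`a`-labelled transition of the cluster, i.e. `postdecomp(C_a) ⊆ post(C_a)`. -/
def DistributedChoice {k : ℕ} (N : NetSys Sig) (D : DistAlphabet Sig k)
    (S : Fin k → Set N.Place) : Prop :=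
  ∀ (x : N.Place ⊕ N.Trans) (a : Sig) (f : ∀ i : D.loc a, N.Place),
    (∀ i : D.loc a, f i ∈ S i.1 ∧
      ∃ t, N.InCluster x (Sum.inr t) ∧ N.label t = a ∧ N.post t (f i)) →
    ∃ t, N.InCluster x (Sum.inr t) ∧ N.label t = a ∧ ∀ i : D.loc a, N.post t (f i)

end NetSys

/-- An S-cover of a labelled net system with respect to a distribution: a family of
sets of places, one per location, covering all places, such that the subnet generated
by `S i` and the transitions labelled in `Σᵢ` is a component, and the initial marking
marks exactly one place of each component (this is S-decomposability). -/
structure SCover {Sig : Type} {k : ℕ} (D : DistAlphabet Sig k) (N : NetSys Sig) where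
  S : Fin k → Set N.Place
  coversPlaces : ∀ p, ∃ i, p ∈ S i
  isComp : ∀ i, N.IsComponent (S i) {t | N.label t ∈ D.comp i}
  initOne : ∀ i, ∃! p, p ∈ S i ∧ 1 ≤ N.initM p
namespace PSG

variable {Sig : Type} {k : ℕ} {D : DistAlphabet Sig k}

/-- The labelled net system constructed from a product system with globals:
places are the local states (of all components), transitions are the global moves
(labelled by their letter), the flow is given by the pre- and post-states of the
component local moves, the initial marking is the initial product state and the
final markings are the final product states. The net is linear in the size of the
product system. -/
noncomputable def toNet [Finite Sig] (A : PSG D) : NetSys Sig where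
  Place := Σ i : Fin k, A.P i
  Trans := Σ a : Sig, {g : ∀ i : D.loc a, A.P i.1 × A.P i.1 // g ∈ A.globals a}
  finiteP := by haveI := A.finite; exact inferInstance
  finiteT := by haveI := A.finite; exact inferInstance
  pre := fun t x => ∃ h : x.1 ∈ D.loc t.1, (t.2.1 ⟨x.1, h⟩).1 = x.2
  post := fun t x => ∃ h : x.1 ∈ D.loc t.1, (t.2.1 ⟨x.1, h⟩).2 = x.2
  preNonempty := fun t => by
    obtain ⟨i, hi⟩ := D.covers t.1
    exact ⟨⟨i, (t.2.1 ⟨i, hi⟩).1⟩, hi, rfl⟩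
  postNonempty := fun t => by
    obtain ⟨i, hi⟩ := D.covers t.1
    exact ⟨⟨i, (t.2.1 ⟨i, hi⟩).2⟩, hi, rfl⟩
  label := fun t => t.1
  initM := fun x => ind (x.2 = A.init x.1)
  finals := (fun (R : ∀ i, A.P i) => fun (x : Σ i : Fin k, A.P i) => ind (x.2 = R x.1)) '' A.final
  finalsFin := by haveI := A.finite; exact (Set.toFinite A.final).image _

/-- The canonical S-cover of the net constructed from a product system with globals:
the `i`-th set of places consists of the local states of the `i`-th component. -/
def canonS (A : PSG D) : Fin k → Set (Σ i : Fin k, A.P i) := fun i => {x | x.1 = i}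

end PSG

namespace NetSys

variable {Sig : Type}

/-- If transitions sharing a pre-place have equal pre-sets, then the net is free choice. -/
theorem freeChoice_of_shared_pre (N : NetSys Sig)
    (h : ∀ t t' p, N.pre t p → N.pre t' p → ∀ q, N.pre t q ↔ N.pre t' q) : N.FreeChoice := by
  rintro (p₀ | t₀) t t' ht ht'
  · have key : ∀ y, N.InCluster (Sum.inl p₀) y →
        Sum.elim (fun p => p = p₀ ∨ ∃ t, N.pre t p₀ ∧ N.pre t p) (fun t => N.pre t p₀) y := by
      intro y hy
      induction hy with
      | base => exact Or.inl rfl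
      | placePost _ hp ih =>
        rcases ih with rfl | ⟨s, hs₀, hs⟩
        · exact hp
        · exact (h _ _ _ hs hp _).1 hs₀
      | transPre _ hp ih => exact Or.inr ⟨_, ih, hp⟩
    exact h _ _ p₀ (key _ ht) (key _ ht')
  · have key : ∀ y, N.InCluster (Sum.inr t₀) y →
        Sum.elim (fun p => N.pre t₀ p) (fun t => ∀ p, N.pre t p ↔ N.pre t₀ p) y := by
      intro y hy
      induction hy with
      | base => exact fun _ => Iff.rfl
      | placePost _ hp ih => exact h _ _ _ hp ih
      | transPre _ hp ih => exact (ih _).1 hp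
    exact fun p => (key _ ht p).trans (key _ ht' p).symm

/-- A transition with the same pre-set as a transition of a cluster belongs to the cluster. -/
theorem InCluster.of_pre_iff {N : NetSys Sig} {x : N.Place ⊕ N.Trans} {t t' : N.Trans}
    (ht : N.InCluster x (Sum.inr t)) (h : ∀ p, N.pre t' p ↔ N.pre t p) :
    N.InCluster x (Sum.inr t') := by
  obtain ⟨p, hp⟩ := N.preNonempty t
  exact (ht.transPre hp).placePost ((h p).2 hp)

end NetSys

namespace PSG

variable {Sig : Type} [Finite Sig] {k : ℕ} {D : DistAlphabet Sig k}

theorem toNet_freeChoice {A : PSG D} (h : A.sameSource) : A.toNet.FreeChoice :=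
  A.toNet.freeChoice_of_shared_pre fun t t' p hp hp' =>
    Set.ext_iff.1 (h t.1 t'.1 t.2.1 t'.2.1 t.2.2 t'.2.2 ⟨p, hp, hp'⟩)

theorem toNet_distributedChoice {A : PSG D} (h : A.sameSource) (hpm : A.productMoves) :
    A.toNet.DistributedChoice D A.canonS := by
  intro x a f hf
  have hmove : ∀ i : D.loc a, ∃ g : {g // g ∈ A.globals a},
      A.toNet.InCluster x (Sum.inr ⟨a, g⟩) ∧ A.toNet.post ⟨a, g⟩ (f i) := by
    intro i
    obtain ⟨-, ⟨b, g⟩, hg, rfl, hpost⟩ := hf i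
    exact ⟨g, hg, hpost⟩
  choose F hF hpost using hmove
  obtain ⟨i₀, hi₀⟩ := D.covers a
  obtain ⟨g, hg, hpre, hgpost⟩ := hpm a (F ⟨i₀, hi₀⟩).1 (F ⟨i₀, hi₀⟩).2 (fun i => (F i).1)
    fun i => ⟨(F i).2, Set.ext (toNet_freeChoice h x _ _ (hF i) (hF ⟨i₀, hi₀⟩))⟩
  refine ⟨⟨a, g, hg⟩, (hF ⟨i₀, hi₀⟩).of_pre_iff (Set.ext_iff.1 hpre), rfl, fun i => ?_⟩
  have hloc := (hf i).1
  have hq := hpost i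
  generalize f i = y at hloc hq
  obtain ⟨j, q⟩ := y
  obtain rfl : j = i.1 := hloc
  obtain ⟨hi, hq⟩ := hq
  exact ⟨hi, (hgpost i).trans hq⟩

end PSG

/-- Let `(N, M₀, 𝒢) = A.toNet` be the net system constructed from a
product system with globals `A`. If `A` has the same source property then the net is
free choice; if in addition `A` has the product moves property then the net has the
distributed choice property (with respect to the canonical S-cover indexed by the
locations). -/
theorem psglobals_to_net_freeChoice_and_distributedChoice
    {Sig : Type} [Finite Sig] {k : ℕ} {D : DistAlphabet Sig k} (A : PSG D) :
    (A.sameSource → A.toNet.FreeChoice) ∧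
    (A.sameSource → A.productMoves → A.toNet.DistributedChoice D A.canonS) := by
  exact ⟨PSG.toNet_freeChoice, PSG.toNet_distributedChoice⟩
end

section
/- Let (N, M₀, 𝒢) be a 1-bounded, S-decomposable labelled net system over a distributed alphabet, and let A be the product system with globals constructed from it (component states = places of each S-component, local moves from the induced flow, globals(a) = {Π_{i∈loc(a)} t[i] | t ∈ T_a}, final states 𝒢). If N is free choice then A has the same source property; if in addition N has the distributed choice property then A has the product moves property. -/
set_option linter.unusedVariables false

open scoped Classical

namespace NetSys

variable {Sig : Type} {k : ℕ} {D : DistAlphabet Sig k}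

/-- The product system with globals constructed from an S-decomposable labelled net
system (with a chosen S-cover `C`): the `i`-th component has the places of the `i`-th
S-component as states, the unique initially marked place of that component as initial
state, local moves induced by the flow, global `a`-moves given by the `a`-labelled
transitions of the net, and the final markings as final product states. The system is
linear in the size of the net. -/
noncomputable def toPSG (N : NetSys Sig) (C : SCover D N) : PSG D where
  P := fun i => ↥(C.S i)
  finite := fun i => by haveI := N.finiteP; exact inferInstance
  init := fun i => ⟨(C.initOne i).exists.choose, (C.initOne i).exists.choose_spec.1⟩
  finalLocal := fun i => {p | ∃ M ∈ N.finals, 1 ≤ M p.1}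
  trans := fun i =>
    {m | m.2.1 ∈ D.comp i ∧ ∃ t, N.label t = m.2.1 ∧ N.pre t m.1.1 ∧ N.post t m.2.2.1}
  trans_mem := fun i m hm => hm.1
  globals := fun a =>
    {g | ∃ t, N.label t = a ∧ ∀ i : D.loc a, N.pre t ((g i).1).1 ∧ N.post t ((g i).2).1}
  globals_trans := fun a g hg i => by
    obtain ⟨t, ht, h⟩ := hg
    exact ⟨i.2, t, ht, (h i).1, (h i).2⟩
  final := {R | ∃ M ∈ N.finals, ∀ (i : Fin k), ∀ p ∈ C.S i, (1 ≤ M p ↔ p = (R i).1)}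

end NetSys

namespace NetSys

/-- In a free choice net, transitions sharing a pre-place have the same pre-set. -/
theorem FreeChoice.pre_iff {Sig : Type} {N : NetSys Sig} (hfc : N.FreeChoice)
    {t t' : N.Trans} {p : N.Place} (h : N.pre t p) (h' : N.pre t' p) (q : N.Place) :
    N.pre t q ↔ N.pre t' q :=
  hfc (Sum.inl p) t t' (.placePost .base h) (.placePost .base h') q

/-- If the pre-set of `t` is contained in that of `t'`, then so are the pre-states of
their global moves. -/
theorem preSet_subset_of_pre {Sig : Type} {k : ℕ} {D : DistAlphabet Sig k}
    {N : NetSys Sig} (C : SCover D N) {a b : Sig}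
    {ga : ∀ i : D.loc a, (N.toPSG C).P i.1 × (N.toPSG C).P i.1}
    {gb : ∀ i : D.loc b, (N.toPSG C).P i.1 × (N.toPSG C).P i.1} {t t' : N.Trans}
    (hb : N.label t' = b) (hga : ∀ i : D.loc a, N.pre t (ga i).1.1)
    (hgb : ∀ i : D.loc b, N.pre t' (gb i).1.1) (h : ∀ p, N.pre t p → N.pre t' p) :
    (N.toPSG C).preSet a ga ⊆ (N.toPSG C).preSet b gb := by
  rintro ⟨i, p⟩ ⟨hi, hp⟩
  dsimp only at hi hp
  have hpre : N.pre t' p.1 := by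
    rw [← hp]
    exact h _ (hga ⟨i, hi⟩)
  have hmem : N.label t' ∈ D.comp i := (C.isComp i).1 p.1 p.2 t' (.inl hpre)
  have hib : i ∈ D.loc b := hb ▸ hmem
  refine ⟨hib, Subtype.ext ?_⟩
  exact ((C.isComp i).2.1 t' hmem).1.unique
    ⟨(gb ⟨i, hib⟩).1.2, hgb ⟨i, hib⟩⟩ ⟨p.2, hpre⟩

theorem FreeChoice.sameSource_toPSG {Sig : Type} {k : ℕ} {D : DistAlphabet Sig k}
    {N : NetSys Sig} (hfc : N.FreeChoice) (C : SCover D N) : (N.toPSG C).sameSource := by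
  rintro a b ga gb ⟨t, ht, hga⟩ ⟨t', ht', hgb⟩ ⟨⟨i, p⟩, ⟨hia, hpa⟩, ⟨hib, hpb⟩⟩
  dsimp only at hia hpa hib hpb
  have hp : N.pre t p.1 := by
    rw [← hpa]
    exact (hga ⟨i, hia⟩).1
  have hp' : N.pre t' p.1 := by
    rw [← hpb]
    exact (hgb ⟨i, hib⟩).1
  have hpre := hfc.pre_iff hp hp'
  exact Set.Subset.antisymm
    (preSet_subset_of_pre C ht' (fun i => (hga i).1) (fun i => (hgb i).1) fun q => (hpre q).1)
    (preSet_subset_of_pre C ht (fun i => (hgb i).1) (fun i => (hga i).1) fun q => (hpre q).2)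

theorem FreeChoice.productMoves_toPSG {Sig : Type} {k : ℕ} {D : DistAlphabet Sig k}
    {N : NetSys Sig} (hfc : N.FreeChoice) (C : SCover D N)
    (hdc : N.DistributedChoice D C.S) : (N.toPSG C).productMoves := by
  rintro a g₀ ⟨t₀, -, hg₀⟩ F hF
  obtain ⟨i₀, hi₀⟩ := D.covers a
  let j : D.loc a := ⟨i₀, hi₀⟩
  have hj : N.InCluster (Sum.inl (g₀ j).1.1) (Sum.inr t₀) := .placePost .base (hg₀ j).1
  obtain ⟨t, htC, hta, hpost⟩ := hdc (Sum.inl (g₀ j).1.1) a (fun i => (F i i).2.1) fun i => by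
    obtain ⟨⟨s, hs, hFs⟩, hpre⟩ := hF i
    refine ⟨(F i i).2.2, s, .placePost .base ?_, hs, (hFs i).2⟩
    have hmem : (⟨i₀, (g₀ j).1⟩ : Σ i, (N.toPSG C).P i) ∈ (N.toPSG C).preSet a (F i) := by
      rw [hpre]
      exact ⟨hi₀, rfl⟩
    obtain ⟨_, heq⟩ := hmem
    dsimp only at heq
    rw [← heq]
    exact (hFs j).1
  exact ⟨fun i => ((g₀ i).1, (F i i).2),
    ⟨t, hta, fun i => ⟨(hfc _ t₀ t hj htC _).1 (hg₀ i).1, hpost i⟩⟩, rfl, fun _ => rfl⟩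

end NetSys

/-- Let `A = N.toPSG C` be the product system with globals
constructed from a 1-bounded, S-decomposable labelled net system `N` (with S-cover
`C`). If `N` is free choice then `A` has the same source property; if in addition
`N` has the distributed choice property then `A` has the product moves property. -/
theorem net_to_psglobals_sameSource_and_productMoves
    {Sig : Type} {k : ℕ} {D : DistAlphabet Sig k} (N : NetSys Sig)
    (C : SCover D N) (hb : N.OneBounded) :
    (N.FreeChoice → (N.toPSG C).sameSource) ∧
    (N.FreeChoice → N.DistributedChoice D C.S → (N.toPSG C).productMoves) :=
  ⟨fun hfc => hfc.sameSource_toPSG C, fun hfc hdc => hfc.productMoves_toPSG C hdc⟩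
end
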